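/- arXiv:1703.01108 — 2 statements merged into one kernel-verified Lean document; each statement's English description precedes it below -/
import Mathlib

section
/- Let d ∈ ℕ_{>0} and let (X,μ) be an essentially free measure-preserving action of ℤ^d on a standard Borel probability space. Then for every k ∈ ℕ and every ε > 0 there exists a measurable subset A ⊆ X such that the translates (γ·A)_{γ ∈ F_k} with F_k = {0,…,k}^d ⊆ ℤ^d are pairwise disjoint and μ(X \ F_k·A) < ε. -/
open scoped Pointwise

namespace Rok
open MeasureTheory

variable {d : ℕ}

def nrm (γ : Fin d → ℤ) : ℕ := Finset.univ.sup (fun i => (γ i).natAbs)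

lemma nrm_le {γ : Fin d → ℤ} {r : ℕ} : nrm γ ≤ r ↔ ∀ i, (γ i).natAbs ≤ r := by
  simp [nrm]

lemma nrm_add (γ δ : Fin d → ℤ) : nrm (γ + δ) ≤ nrm γ + nrm δ := by
  rw [nrm_le]
  intro i
  have h1 := nrm_le.1 (le_refl (nrm γ)) i
  have h2 := nrm_le.1 (le_refl (nrm δ)) i
  simp only [Pi.add_apply]
  omega

lemma nrm_neg (γ : Fin d → ℤ) : nrm (-γ) = nrm γ := by
  simp [nrm]

lemma nrm_zero : nrm (0 : Fin d → ℤ) = 0 := by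
  simp [nrm]

lemma exists_marker {X : Type*} [MeasurableSpace X] [AddAction (Fin d → ℤ) X]
    (hm : ∀ γ : Fin d → ℤ, Measurable (fun x : X => γ +ᵥ x))
    (f : X → ℝ) (hf : Measurable f) (hinj : Function.Injective f) (R : ℕ) :
    ∃ B : Set X, MeasurableSet B ∧
      (∀ x ∈ B, ∀ γ : Fin d → ℤ, γ ≠ 0 → nrm γ ≤ R → γ +ᵥ x ∉ B) ∧
      (∀ x : X, (∀ γ : Fin d → ℤ, γ ≠ 0 → γ +ᵥ x ≠ x) →
        ∃ γ : Fin d → ℤ, nrm γ ≤ R ∧ γ +ᵥ x ∈ B) := by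
  classical
  let V : ℚ × ℚ → Set X := fun p => {x | f x ∈ Set.Ioo (p.1 : ℝ) p.2 ∧
    ∀ γ : Fin d → ℤ, γ ≠ 0 → nrm γ ≤ R → f (γ +ᵥ x) ∉ Set.Ioo (p.1 : ℝ) p.2}
  have hV : ∀ p, MeasurableSet (V p) := by
    intro p
    have : V p = f ⁻¹' Set.Ioo (p.1 : ℝ) p.2 ∩ ⋂ γ : Fin d → ℤ, ⋂ _ : γ ≠ 0, ⋂ _ : nrm γ ≤ R,
        ((fun x : X => γ +ᵥ x) ⁻¹' (f ⁻¹' Set.Ioo (p.1 : ℝ) p.2))ᶜ := by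
      ext x; simp [V]
    rw [this]
    refine (hf measurableSet_Ioo).inter ?_
    refine MeasurableSet.iInter fun γ => MeasurableSet.iInter fun _ => MeasurableSet.iInter fun _ => ?_
    exact (hm γ (hf measurableSet_Ioo)).compl
  obtain ⟨e, he⟩ := exists_surjective_nat (ℚ × ℚ)
  let U : ℕ → Set X := fun n => V (e n)
  let C : ℕ → Set X := fun n => Nat.rec ∅ (fun n Cn => Cn ∪ (U n \ ⋃ γ : Fin d → ℤ, ⋃ _ : nrm γ ≤ R,
    (fun x : X => γ +ᵥ x) ⁻¹' Cn)) n
  have hC0 : C 0 = ∅ := rfl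
  have hCs : ∀ n, C (n+1) = C n ∪ (U n \ ⋃ γ : Fin d → ℤ, ⋃ _ : nrm γ ≤ R,
    (fun x : X => γ +ᵥ x) ⁻¹' (C n)) := fun n => rfl
  have hCm : ∀ n, MeasurableSet (C n) := by
    intro n
    induction n with
    | zero => rw [hC0]; exact MeasurableSet.empty
    | succ n ih =>
      rw [hCs]
      exact ih.union ((hV _).diff (MeasurableSet.iUnion fun γ => MeasurableSet.iUnion fun _ => hm γ ih))
  have hmono : Monotone C := monotone_nat_of_le_succ fun n => by
    rw [hCs]; exact Set.subset_union_left
  have hsep : ∀ n, ∀ x ∈ C n, ∀ γ : Fin d → ℤ, γ ≠ 0 → nrm γ ≤ R → γ +ᵥ x ∉ C n := by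
    intro n
    induction n with
    | zero => intro x hx; simp [hC0] at hx
    | succ n ih =>
      intro x hx γ h0 hR hx'
      rw [hCs] at hx hx'
      rcases hx with hx | ⟨hx, hx2⟩ <;> rcases hx' with hx' | ⟨hx', hx2'⟩
      · exact ih x hx γ h0 hR hx'
      · apply hx2'
        simp only [Set.mem_iUnion]
        exact ⟨-γ, by rwa [nrm_neg], by simpa using hx⟩
      · apply hx2
        simp only [Set.mem_iUnion]
        exact ⟨γ, hR, hx'⟩
      · exact hx.2 γ h0 hR hx'.1
  refine ⟨⋃ n, C n, MeasurableSet.iUnion hCm, ?_, ?_⟩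
  · intro x hx γ h0 hR hx'
    obtain ⟨n, hn⟩ := Set.mem_iUnion.1 hx
    obtain ⟨m, hm'⟩ := Set.mem_iUnion.1 hx'
    exact hsep (max n m) x (hmono (le_max_left _ _) hn) γ h0 hR (hmono (le_max_right _ _) hm')
  · intro x hx
    have hfin : Set.Finite {γ : Fin d → ℤ | nrm γ ≤ R} := by
      refine (Set.finite_Icc (fun _ : Fin d => -(R:ℤ)) (fun _ => (R:ℤ))).subset ?_
      intro γ hγ
      have := nrm_le.1 hγ
      exact ⟨fun i => by have := this i; simp only; omega, fun i => by have := this i; simp only; omega⟩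
    have hT : Set.Finite ((fun γ : Fin d → ℤ => f (γ +ᵥ x)) '' {γ | γ ≠ 0 ∧ nrm γ ≤ R}) :=
      (hfin.subset fun γ h => h.2).image _
    have hnot : f x ∈ ((fun γ : Fin d → ℤ => f (γ +ᵥ x)) '' {γ | γ ≠ 0 ∧ nrm γ ≤ R})ᶜ := by
      rintro ⟨γ, ⟨h0, -⟩, h⟩
      exact hx γ h0 (hinj h)
    obtain ⟨δ, hδ, hball⟩ := Metric.isOpen_iff.1 hT.isClosed.isOpen_compl _ hnot
    rw [Real.ball_eq_Ioo] at hball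
    obtain ⟨p, hp1, hp2⟩ := exists_rat_btwn (show f x - δ < f x by linarith)
    obtain ⟨q, hq1, hq2⟩ := exists_rat_btwn (show f x < f x + δ by linarith)
    obtain ⟨n, hn⟩ := he (p, q)
    have hU : x ∈ U n := by
      change x ∈ V (e n)
      rw [hn]
      refine ⟨⟨hp2, hq1⟩, ?_⟩
      intro γ h0 hR hmem
      exact hball ⟨hp1.trans hmem.1, hmem.2.trans hq2⟩ ⟨γ, ⟨h0, hR⟩, rfl⟩
    by_cases h : x ∈ ⋃ γ : Fin d → ℤ, ⋃ _ : nrm γ ≤ R, (fun x : X => γ +ᵥ x) ⁻¹' (C n)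
    · simp only [Set.mem_iUnion] at h
      obtain ⟨γ, hR, h⟩ := h
      exact ⟨γ, hR, Set.mem_iUnion.2 ⟨n, h⟩⟩
    · refine ⟨0, by simp [nrm_zero], Set.mem_iUnion.2 ⟨n+1, ?_⟩⟩
      rw [zero_vadd, hCs]
      exact Or.inr ⟨hU, h⟩

lemma count_bad {X : Type*} [AddAction (Fin d → ℤ) X] (B : Set X) (R k : ℕ) (hk : k ≤ R)
    (hsep : ∀ x ∈ B, ∀ γ : Fin d → ℤ, γ ≠ 0 → nrm γ ≤ R → γ +ᵥ x ∉ B) (x : X)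
    (S : Finset ℕ) (hS : ∀ r ∈ S, r < 2 * R ∧
      ∃ γ : Fin d → ℤ, γ +ᵥ x ∈ B ∧ nrm γ ≤ r + k ∧ r ≤ nrm γ + k) :
    S.card ≤ 7 ^ d * (2 * k + 1) := by
  classical
  choose! hlt g hgB hg1 hg2 using hS
  let q : (Fin d → ℤ) → (Fin d → ℤ) := fun γ i => γ i / ((R : ℤ) + 1)
  let T : Finset ((Fin d → ℤ) × ℤ) :=
    (Fintype.piFinset fun _ : Fin d => Finset.Icc (-3 : ℤ) 3) ×ˢ Finset.Icc (-(k:ℤ)) k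
  have hT : T.card = 7 ^ d * (2 * k + 1) := by
    simp only [T, Finset.card_product, Fintype.card_piFinset, Int.card_Icc]
    simp
    omega
  rw [← hT]
  refine Finset.card_le_card_of_injOn (fun r => (q (g r), (r : ℤ) - nrm (g r))) ?_ ?_
  · intro r hr
    have h1 := hg1 r hr
    have h2 := hg2 r hr
    have h3 := hlt r hr
    simp only [T, Finset.coe_product, Set.mem_prod, Finset.mem_coe, Fintype.mem_piFinset, Finset.mem_Icc]
    refine ⟨fun i => ?_, by omega, by omega⟩
    have h4 := nrm_le.1 (le_refl (nrm (g r))) i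
    have hpos : (0:ℤ) < (R:ℤ) + 1 := by omega
    constructor
    · rw [Int.le_ediv_iff_mul_le hpos]; omega
    · have : q (g r) i < 4 := by
        rw [Int.ediv_lt_iff_lt_mul hpos]; omega
      omega
  · intro r hr s hs h
    simp only [Prod.mk.injEq] at h
    have hgg : g r = g s := by
      by_contra hne
      refine hsep _ (hgB s hs) (g r - g s) (sub_ne_zero.2 hne) ?_ ?_
      · rw [nrm_le]
        intro i
        have hi : g r i / ((R:ℤ)+1) = g s i / ((R:ℤ)+1) := congrFun h.1 i
        have e1 := Int.mul_ediv_add_emod (g r i) ((R:ℤ)+1)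
        have e2 := Int.mul_ediv_add_emod (g s i) ((R:ℤ)+1)
        have hpos : (0:ℤ) < (R:ℤ) + 1 := by omega
        have m1 := Int.emod_lt_of_pos (g r i) hpos
        have m2 := Int.emod_lt_of_pos (g s i) hpos
        have m3 := Int.emod_nonneg (g r i) hpos.ne'
        have m4 := Int.emod_nonneg (g s i) hpos.ne'
        rw [hi] at e1
        simp only [Pi.sub_apply]
        generalize ((R:ℤ)+1) * (g s i / ((R:ℤ)+1)) = w at *
        omega
      · rw [vadd_vadd, sub_add_cancel]; exact hgB r hr
    have := h.2
    rw [hgg] at this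
    omega

lemma measurable_bad {X : Type*} [MeasurableSpace X] [AddAction (Fin d → ℤ) X]
    (hm : ∀ γ : Fin d → ℤ, Measurable (fun x : X => γ +ᵥ x)) (B : Set X) (hB : MeasurableSet B)
    (P : (Fin d → ℤ) → Prop) :
    MeasurableSet {x : X | ∃ γ : Fin d → ℤ, γ +ᵥ x ∈ B ∧ P γ} := by
  have : {x : X | ∃ γ : Fin d → ℤ, γ +ᵥ x ∈ B ∧ P γ} =
      ⋃ γ : Fin d → ℤ, ⋃ _ : P γ, (fun x : X => γ +ᵥ x) ⁻¹' B := by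
    ext x; simp [and_comm]
  rw [this]
  exact MeasurableSet.iUnion fun γ => MeasurableSet.iUnion fun _ => hm γ hB

lemma exists_radius {X : Type*} [MeasurableSpace X] (μ : Measure X) [IsProbabilityMeasure μ]
    (Bad : ℕ → Set X) (hB : ∀ r, MeasurableSet (Bad r)) (R C : ℕ) (ε : ℝ) (hε : 0 < ε)
    (hR : (C : ℝ) < R * ε)
    (hc : ∀ x, ∀ S : Finset ℕ, (∀ r ∈ S, r < 2 * R ∧ x ∈ Bad r) → S.card ≤ C) :
    ∃ r, R ≤ r ∧ μ (Bad r) < ENNReal.ofReal ε := by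
  classical
  by_contra! hcon
  have h1 : ∑ r ∈ Finset.Ico R (2 * R), μ (Bad r) ≤ C := by
    calc ∑ r ∈ Finset.Ico R (2 * R), μ (Bad r)
        = ∑ r ∈ Finset.Ico R (2 * R), ∫⁻ x, (Bad r).indicator 1 x ∂μ := by
          refine Finset.sum_congr rfl fun r _ => ?_
          rw [lintegral_indicator_one (hB r)]
      _ = ∫⁻ x, ∑ r ∈ Finset.Ico R (2 * R), (Bad r).indicator 1 x ∂μ := by
          rw [lintegral_finsetSum]
          intro r _
          exact measurable_one.indicator (hB r)
      _ ≤ ∫⁻ _, (C : ENNReal) ∂μ := by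
          refine lintegral_mono fun x => ?_
          have : ∑ r ∈ Finset.Ico R (2 * R), (Bad r).indicator (1 : X → ENNReal) x
              = (((Finset.Ico R (2 * R)).filter (fun r => x ∈ Bad r)).card : ENNReal) := by
            simp [Set.indicator_apply, Finset.sum_ite]
          simp only [this]
          refine Nat.cast_le.2 (hc x _ ?_)
          intro r hr
          simp only [Finset.mem_filter, Finset.mem_Ico] at hr
          exact ⟨hr.1.2, hr.2⟩
      _ = C := by simp
  have h2 : (R : ENNReal) * ENNReal.ofReal ε ≤ ∑ r ∈ Finset.Ico R (2 * R), μ (Bad r) := by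
    have := Finset.card_nsmul_le_sum (Finset.Ico R (2 * R)) (fun r => μ (Bad r)) (ENNReal.ofReal ε)
      (fun r hr => hcon r (Finset.mem_Ico.1 hr).1)
    have hcard : 2 * R - R = R := by omega
    simpa [hcard] using this
  have h3 := h2.trans h1
  rw [← ENNReal.ofReal_natCast R, ← ENNReal.ofReal_mul (by positivity), ← ENNReal.ofReal_natCast C,
    ENNReal.ofReal_le_ofReal_iff (by positivity)] at h3
  linarith

end Rok

/-- **Rokhlin lemma for free abelian groups.**
Let `d > 0` and let `(X,μ)` be an essentially free measure-preserving action of `ℤ^d` on a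
standard Borel probability space.  Then for every `k ∈ ℕ` and every `ε > 0` there is a
measurable set `A ⊆ X` such that the translates `γ +ᵥ A` for `γ ∈ F_k = {0,…,k}^d` are
pairwise disjoint and `μ(X \ F_k·A) < ε`. -/
theorem rokhlin_free_abelian
    (d : ℕ) (hd : 0 < d)
    (X : Type*) [MeasurableSpace X] [StandardBorelSpace X]
    (μ : MeasureTheory.Measure X) [MeasureTheory.IsProbabilityMeasure μ]
    [AddAction (Fin d → ℤ) X]
    (hmp : ∀ γ : Fin d → ℤ, MeasureTheory.MeasurePreserving (fun x : X => γ +ᵥ x) μ μ)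
    (hfree : μ {x : X | ∃ γ : Fin d → ℤ, γ ≠ 0 ∧ γ +ᵥ x = x} = 0)
    (k : ℕ) (ε : ℝ) (hε : 0 < ε) :
    ∃ A : Set X, MeasurableSet A ∧
      (∀ γ δ : Fin d → ℤ,
        (∀ i, 0 ≤ γ i ∧ γ i ≤ k) → (∀ i, 0 ≤ δ i ∧ δ i ≤ k) → γ ≠ δ →
          Disjoint (γ +ᵥ A) (δ +ᵥ A)) ∧
      μ (Set.univ \ ⋃ γ ∈ {γ : Fin d → ℤ | ∀ i, 0 ≤ γ i ∧ γ i ≤ k}, γ +ᵥ A)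
        < ENNReal.ofReal ε := by
  classical
  have hm : ∀ γ : Fin d → ℤ, Measurable (fun x : X => γ +ᵥ x) := fun γ => (hmp γ).measurable
  obtain ⟨f, hfe⟩ := MeasureTheory.exists_measurableEmbedding_real X
  have hf := hfe.measurable
  have hinj := hfe.injective
  obtain ⟨R0, hR0⟩ := exists_nat_gt (((7 ^ d * (2 * k + 1) : ℕ) : ℝ) / ε)
  set R := R0 + k with hRdef
  have hR : ((7 ^ d * (2 * k + 1) : ℕ) : ℝ) < R * ε := by
    rw [div_lt_iff₀ hε] at hR0
    have : (R0 : ℝ) ≤ R := by exact_mod_cast Nat.le_add_right _ _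
    nlinarith
  obtain ⟨B, hBm, hsep, hdense⟩ := Rok.exists_marker hm f hf hinj R
  obtain ⟨r, hRr, hbad⟩ := Rok.exists_radius μ
    (fun r => {x : X | ∃ γ : Fin d → ℤ, γ +ᵥ x ∈ B ∧ (Rok.nrm γ ≤ r + k ∧ r ≤ Rok.nrm γ + k)})
    (fun r => Rok.measurable_bad hm B hBm _) R _ ε hε hR
    (fun x S hS => Rok.count_bad B R k (by omega) hsep x S hS)
  let Free : Set X := {x | ∀ γ : Fin d → ℤ, γ ≠ 0 → γ +ᵥ x ≠ x}
  have hFreeM : MeasurableSet Free := by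
    have : Free = ⋂ γ : Fin d → ℤ, ⋂ _ : γ ≠ 0, {x : X | f (γ +ᵥ x) = f x}ᶜ := by
      ext x; simp [Free, hinj.eq_iff]
    rw [this]
    exact MeasurableSet.iInter fun γ => MeasurableSet.iInter fun _ =>
      (measurableSet_eq_fun (hf.comp (hm γ)) hf).compl
  have hFinv : ∀ x ∈ Free, ∀ δ : Fin d → ℤ, δ +ᵥ x ∈ Free := by
    intro x hx δ γ h0 h
    apply hx γ h0
    rw [vadd_comm] at h
    exact (vadd_left_cancel_iff δ).1 h
  have hFuniq : ∀ x ∈ Free, ∀ γ δ : Fin d → ℤ, γ +ᵥ x = δ +ᵥ x → γ = δ := by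
    intro x hx γ δ h
    by_contra hne
    apply hx (-δ + γ) (by intro h'; apply hne; exact (neg_add_eq_zero.1 h').symm)
    rw [← vadd_vadd, h, neg_vadd_vadd]
  let asg : X → (Fin d → ℤ) → Prop := fun x γ => γ +ᵥ x ∈ B ∧ Rok.nrm γ ≤ r ∧
    ∀ δ : Fin d → ℤ, Rok.nrm δ ≤ r → δ +ᵥ x ∈ B → f (γ +ᵥ x) ≤ f (δ +ᵥ x)
  have hasgM : ∀ γ, MeasurableSet {x | asg x γ} := by
    intro γ
    have : {x | asg x γ} = (fun x : X => γ +ᵥ x) ⁻¹' B ∩ ({x | Rok.nrm γ ≤ r} ∩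
      ⋂ δ : Fin d → ℤ, ⋂ _ : Rok.nrm δ ≤ r, (((fun x : X => δ +ᵥ x) ⁻¹' B)ᶜ ∪
        {x | f (γ +ᵥ x) ≤ f (δ +ᵥ x)})) := by
      ext x
      simp [asg, imp_iff_not_or]
    rw [this]
    refine (hm γ hBm).inter ((MeasurableSet.const _).inter ?_)
    refine MeasurableSet.iInter fun δ => MeasurableSet.iInter fun _ => ?_
    exact (hm δ hBm).compl.union (measurableSet_le (hf.comp (hm γ)) (hf.comp (hm δ)))
  have hasgU : ∀ x ∈ Free, ∀ γ δ, asg x γ → asg x δ → γ = δ := by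
    intro x hx γ δ h1 h2
    exact hFuniq x hx γ δ (hinj (le_antisymm (h1.2.2 δ h2.2.1 h2.1) (h2.2.2 γ h1.2.1 h1.1)))
  let F : Set (Fin d → ℤ) := {γ | ∀ i, 0 ≤ γ i ∧ γ i ≤ k}
  let A : Set X := {x | x ∈ Free ∧ ∃ γ : Fin d → ℤ, (∀ i, ((k:ℤ)+1) ∣ γ i) ∧
    ∀ δ ∈ F, asg (δ +ᵥ x) (γ - δ)}
  have hAM : MeasurableSet A := by
    have : A = Free ∩ ⋃ γ : Fin d → ℤ, ⋃ _ : (∀ i, ((k:ℤ)+1) ∣ γ i),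
        ⋂ δ : Fin d → ℤ, ⋂ _ : δ ∈ F, (fun x : X => δ +ᵥ x) ⁻¹' {x | asg x (γ - δ)} := by
      ext x; simp [A]
    rw [this]
    exact hFreeM.inter (MeasurableSet.iUnion fun γ => MeasurableSet.iUnion fun _ =>
      MeasurableSet.iInter fun δ => MeasurableSet.iInter fun _ => hm δ (hasgM _))
  refine ⟨A, hAM, ?_, ?_⟩
  · intro γ δ hγ hδ hne
    rw [Set.disjoint_left]
    rintro _ ⟨a, ⟨haF, g, hg, hga⟩, rfl⟩ ⟨b, ⟨hbF, g', hg', hgb⟩, hab⟩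
    have hab : δ +ᵥ b = γ +ᵥ a := hab
    apply hne
    have h1 := hga γ hγ
    have h2 := hgb δ hδ
    rw [hab] at h2
    have h3 := hasgU _ (hFinv a haF γ) _ _ h1 h2
    funext i
    have h4 := congrFun h3 i
    simp only [Pi.sub_apply] at h4
    have h5 : ((k:ℤ)+1) ∣ γ i - δ i := by
      have : γ i - δ i = g i - g' i := by omega
      rw [this]
      exact dvd_sub (hg i) (hg' i)
    have h6 := Int.eq_zero_of_abs_lt_dvd h5 (by
      have := hγ i; have := hδ i; rw [abs_lt]; omega)
    omega
  · refine lt_of_le_of_lt ?_ hbad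
    have hsub : Set.univ \ ⋃ γ ∈ {γ : Fin d → ℤ | ∀ i, 0 ≤ γ i ∧ γ i ≤ k}, γ +ᵥ A ⊆
        {x : X | ∃ γ : Fin d → ℤ, γ +ᵥ x ∈ B ∧ (Rok.nrm γ ≤ r + k ∧ r ≤ Rok.nrm γ + k)} ∪
        {x : X | ∃ γ : Fin d → ℤ, γ ≠ 0 ∧ γ +ᵥ x = x} := by
      rintro y ⟨-, hy⟩
      by_contra hcon
      simp only [Set.mem_union, Set.mem_setOf_eq, not_or, not_exists, not_and, not_le] at hcon
      obtain ⟨hgood, hfr⟩ := hcon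
      apply hy
      have hyF : y ∈ Free := hfr
      -- existence of the assigned centre
      have hfin : Set.Finite {γ : Fin d → ℤ | Rok.nrm γ ≤ r ∧ γ +ᵥ y ∈ B} := by
        refine (Set.finite_Icc (fun _ : Fin d => -(r:ℤ)) (fun _ => (r:ℤ))).subset ?_
        intro γ hγ
        have := Rok.nrm_le.1 hγ.1
        exact ⟨fun i => by have := this i; simp only; omega,
          fun i => by have := this i; simp only; omega⟩
      obtain ⟨γ0, hγ0, hγ0B⟩ := hdense y hyF
      obtain ⟨c, ⟨hcr, hcB⟩, hcmin⟩ := Set.exists_min_image _ (fun γ : Fin d → ℤ => f (γ +ᵥ y)) hfin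
        ⟨γ0, hγ0.trans hRr, hγ0B⟩
      have hkey : ∀ η : Fin d → ℤ, Rok.nrm η ≤ k → asg (η +ᵥ y) (c - η) := by
        intro η hη
        have hback : ∀ δ : Fin d → ℤ, Rok.nrm δ ≤ r + k → δ +ᵥ y ∈ B → Rok.nrm δ + k < r := by
          intro δ h1 h2
          exact hgood δ h2 h1
        refine ⟨?_, ?_, ?_⟩
        · rwa [vadd_vadd, sub_add_cancel]
        · have h1 := hback c (by omega) hcB
          have h2 := Rok.nrm_add c (-η)
          rw [Rok.nrm_neg, ← sub_eq_add_neg] at h2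
          omega
        · intro δ hδ hδB
          rw [vadd_vadd] at hδB
          have h2 := Rok.nrm_add δ η
          have h1 := hback (δ + η) (by omega) hδB
          rw [vadd_vadd, vadd_vadd, sub_add_cancel]
          exact hcmin (δ + η) ⟨by omega, hδB⟩
      have hpos : (0:ℤ) < (k:ℤ) + 1 := by omega
      -- `y = γ + a` with `γ ∈ F`, `c + γ` divisible
      let γ : Fin d → ℤ := fun i => (- c i) % ((k:ℤ)+1)
      have hγF : γ ∈ F := by
        intro i
        have m1 := Int.emod_lt_of_pos (- c i) hpos
        have m3 := Int.emod_nonneg (- c i) hpos.ne'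
        simp only [γ]
        omega
      simp only [Set.mem_iUnion]
      refine ⟨γ, hγF, -γ +ᵥ y, ⟨hFinv y hyF _, c + γ, ?_, ?_⟩, ?_⟩
      · intro i
        have e1 := Int.mul_ediv_add_emod (- c i) ((k:ℤ)+1)
        refine ⟨-((- c i) / ((k:ℤ)+1)), ?_⟩
        simp only [Pi.add_apply, γ]
        linarith
      · intro δ hδ
        have := hkey (δ + -γ) (by
          rw [Rok.nrm_le]
          intro i
          have := hδ i
          have := hγF i
          simp only [Pi.add_apply, Pi.neg_apply]
          omega)
        rw [vadd_vadd]
        convert this using 1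
        abel
      · simp
    refine (MeasureTheory.measure_mono hsub).trans ((MeasureTheory.measure_union_le _ _).trans ?_)
    rw [hfree, add_zero]
end

section
/- Let Γ be a countable amenable residually finite group and S ⊆ Γ a finite subset. Then there exist a decreasing sequence (Γ_k) of finite-index normal subgroups of Γ with ⋂_k Γ_k = {e} and a Følner sequence (F_k) of Γ with respect to S such that for every k, F_k is a complete set of coset representatives for Γ/Γ_k. -/
open scoped BigOperators

/-- A real-valued function on a set is bounded. -/
def BddFun {Γ : Type*} (f : Γ → ℝ) : Prop := ∃ C : ℝ, ∀ x, |f x| ≤ C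

/-- A group is amenable if it admits a left-invariant mean on `ℓ^∞(Γ;ℝ)`:
an ℝ-linear, normalised, positive functional on the bounded real-valued functions that is
invariant under the `Γ`-action induced by right translation. -/
def IsAmenable (Γ : Type*) [Group Γ] : Prop :=
  ∃ m : (Γ → ℝ) → ℝ,
    (∀ f g : Γ → ℝ, BddFun f → BddFun g → m (f + g) = m f + m g) ∧
    (∀ (c : ℝ) (f : Γ → ℝ), BddFun f → m (c • f) = c * m f) ∧
    m (fun _ => 1) = 1 ∧
    (∀ f : Γ → ℝ, BddFun f → (∀ x, 0 ≤ f x) → 0 ≤ m f) ∧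
    (∀ (γ : Γ) (f : Γ → ℝ), BddFun f → m (fun x => f (x * γ)) = m f)

open scoped Pointwise in
open Classical in
theorem aux_no_doubling {Γ : Type*} [Group Γ] (ham : IsAmenable Γ) (K : Finset Γ) :
    ¬ ∀ F : Finset Γ, 2 * F.card ≤ (F * K).card := by
  intro h
  obtain ⟨m, hadd, hsmul, hone, hpos, hinv⟩ := ham
  let t : Γ × Bool → Finset Γ := fun p => K.image (fun k => p.1 * k)
  have hall : ∀ s : Finset (Γ × Bool), s.card ≤ (s.biUnion t).card := by
    intro s
    have h1 : s ⊆ (s.image Prod.fst) ×ˢ (Finset.univ : Finset Bool) := by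
      intro p hp
      simp only [Finset.mem_product, Finset.mem_univ, and_true]
      exact Finset.mem_image_of_mem _ hp
    have h2 := Finset.card_le_card h1
    rw [Finset.card_product] at h2
    have h3 : (s.image Prod.fst) * K ⊆ s.biUnion t := by
      intro y hy
      obtain ⟨a, ha, k, hk, rfl⟩ := Finset.mem_mul.1 hy
      obtain ⟨p, hp, rfl⟩ := Finset.mem_image.1 ha
      exact Finset.mem_biUnion.2 ⟨p, hp, Finset.mem_image.2 ⟨k, hk, rfl⟩⟩
    have h4 := Finset.card_le_card h3
    have h5 := h (s.image Prod.fst)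
    simp at h2
    omega
  obtain ⟨φ, hinj, hφ⟩ := (Finset.all_card_le_biUnion_card_iff_exists_injective t).1 hall
  let f : Bool → Γ → Γ → ℝ := fun b k x => if φ (x, b) = x * k then 1 else 0
  have hf : ∀ b k, BddFun (f b k) := by
    intro b k
    refine ⟨1, fun x => ?_⟩
    simp only [f]
    split_ifs <;> simp
  have hf' : ∀ b k, BddFun (fun x => f b k (x * k⁻¹)) := by
    intro b k
    obtain ⟨C, hC⟩ := hf b k
    exact ⟨C, fun x => hC _⟩
  have hzero : m 0 = 0 := by
    have := hsmul 0 0 ⟨0, by simp⟩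
    simpa using this
  have hbsum : ∀ {ι : Type _} (s : Finset ι) (g : ι → Γ → ℝ), (∀ i, BddFun (g i)) →
      BddFun (∑ i ∈ s, g i) := by
    intro ι s g hg
    choose C hC using hg
    refine ⟨∑ i ∈ s, C i, fun x => ?_⟩
    rw [Finset.sum_apply]
    exact (Finset.abs_sum_le_sum_abs _ _).trans (Finset.sum_le_sum fun i _ => hC i x)
  have hsum : ∀ {ι : Type _} (s : Finset ι) (g : ι → Γ → ℝ), (∀ i, BddFun (g i)) →
      m (∑ i ∈ s, g i) = ∑ i ∈ s, m (g i) := by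
    intro ι s g hg
    induction s using Finset.induction_on with
    | empty => simpa using hzero
    | insert a s ha ih =>
      rw [Finset.sum_insert ha, Finset.sum_insert ha, hadd _ _ (hg a) (hbsum s g hg), ih]
  have e1 : ∀ b, ∑ k ∈ K, m (f b k) = 1 := by
    intro b
    rw [← hsum K (f b) (hf b), ← hone]
    congr 1
    funext x
    rw [Finset.sum_apply]
    obtain ⟨k, hk, hkx⟩ := Finset.mem_image.1 (hφ (x, b))
    simp only at hkx
    rw [Finset.sum_eq_single k]
    · simp [f, hkx]
    · intro k' _ hne
      simp only [f]
      rw [if_neg]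
      rw [← hkx]
      intro h'
      exact hne (mul_left_cancel h').symm
    · intro h'
      exact absurd hk h'
  let g : Bool × Γ → Γ → ℝ := fun p x => f p.1 p.2 (x * p.2⁻¹)
  have hg : ∀ p, BddFun (g p) := fun p => hf' p.1 p.2
  let T : Finset (Bool × Γ) := Finset.univ ×ˢ K
  have e2 : m (∑ p ∈ T, g p) = 2 := by
    rw [hsum T g hg]
    have : ∀ p, m (g p) = m (f p.1 p.2) := fun p => hinv p.2⁻¹ _ (hf p.1 p.2)
    simp only [this]
    rw [Finset.sum_product]
    simp only [e1]
    norm_num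
  have e3 : ∀ x, (∑ p ∈ T, g p) x ≤ 1 := by
    intro x
    rw [Finset.sum_apply]
    have hgg : ∀ p, g p x = if φ (x * p.2⁻¹, p.1) = x then 1 else 0 := by
      intro p
      simp [g, f]
    simp only [hgg]
    rw [Finset.sum_boole]
    have : (T.filter fun p => φ (x * p.2⁻¹, p.1) = x).card ≤ 1 := by
      rw [Finset.card_le_one]
      intro p hp q hq
      have h1 := (Finset.mem_filter.1 hp).2
      have h2 := (Finset.mem_filter.1 hq).2
      have h3 := hinj (h1.trans h2.symm)
      simp only [Prod.mk.injEq, mul_right_inj, inv_inj] at h3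
      exact Prod.ext h3.2 h3.1
    exact_mod_cast this
  have hB := hbsum T g hg
  have e4 : 0 ≤ m ((fun _ => 1) + (-1 : ℝ) • (∑ p ∈ T, g p)) := by
    apply hpos
    · obtain ⟨C, hC⟩ := hB
      refine ⟨1 + C, fun x => ?_⟩
      have := hC x
      simp only [Pi.add_apply, Pi.smul_apply, smul_eq_mul]
      rw [abs_le] at *
      constructor <;> linarith [this.1, this.2]
    · intro x
      have := e3 x
      simp only [Pi.add_apply, Pi.smul_apply, smul_eq_mul]
      linarith
  rw [hadd _ _ ⟨1, by simp⟩ ?_, hsmul _ _ hB, hone, e2] at e4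
  · norm_num at e4
  · obtain ⟨C, hC⟩ := hB
    refine ⟨C, fun x => ?_⟩
    simpa using hC x

open scoped Pointwise in
open Classical in
theorem aux_folner {Γ : Type*} [Group Γ] (ham : IsAmenable Γ) (K : Finset Γ) (ε : ℝ)
    (hε : 0 < ε) : ∃ F : Finset Γ, F.Nonempty ∧ ((F * K).card : ℝ) ≤ (1 + ε) * F.card := by
  by_contra! h
  have h1 : ∀ F : Finset Γ, (1 + ε) * F.card ≤ ((F * K).card : ℝ) := by
    intro F
    rcases F.eq_empty_or_nonempty with rfl | hF
    · simp
    · exact (h F hF).le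
  have h2 : ∀ (n : ℕ) (F : Finset Γ), (1 + ε) ^ n * F.card ≤ ((F * K ^ n).card : ℝ) := by
    intro n
    induction n with
    | zero => intro F; simp
    | succ n ih =>
      intro F
      have a := ih F
      have b := h1 (F * K ^ n)
      rw [pow_succ K, ← mul_assoc F]
      refine le_trans ?_ b
      calc (1 + ε) ^ (n + 1) * (F.card : ℝ) = (1 + ε) * ((1 + ε) ^ n * F.card) := by ring
        _ ≤ _ := by gcongr
  obtain ⟨n, hn⟩ := pow_unbounded_of_one_lt 2 (show 1 < 1 + ε by linarith)
  apply aux_no_doubling ham (K ^ n)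
  intro F
  have := h2 n F
  have h3 : (2 : ℝ) * F.card ≤ (F * K ^ n).card := by
    refine le_trans ?_ this
    gcongr
  exact_mod_cast h3

open Classical in
theorem aux_perm {Q : Type*} [Fintype Q] (U V : Finset Q) (hVU : V ⊆ U)
    (hU : U.Nonempty) :
    (Finset.univ.filter fun σ : Q ≃ Fin (Fintype.card Q) =>
      ∃ q ∈ V, ∀ u ∈ U, σ q ≤ σ u).card * U.card
      = V.card * Fintype.card (Q ≃ Fin (Fintype.card Q)) := by
  let A : Q → Finset (Q ≃ Fin (Fintype.card Q)) := fun q =>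
    Finset.univ.filter fun σ => ∀ u ∈ U, σ q ≤ σ u
  have hA : ∀ q ∈ U, ∀ q' ∈ U, (A q).card ≤ (A q').card := by
    intro q hq q' hq'
    refine Finset.card_le_card_of_injOn (fun σ => (Equiv.swap q q').trans σ) ?_ ?_
    · intro σ hσ
      simp only [A, Finset.coe_filter, Finset.mem_univ, true_and, Set.mem_ofPred_eq] at hσ ⊢
      intro u hu
      simp only [Equiv.trans_apply, Equiv.swap_apply_right]
      apply hσ
      rw [Equiv.swap_apply_def]
      split_ifs <;> assumption
    · intro σ _ τ _ hst
      ext x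
      have := congrArg (fun e : Q ≃ Fin (Fintype.card Q) => e (Equiv.swap q q' x)) hst
      simpa using congrArg Fin.val this
  have hcount : ∀ W ⊆ U, (Finset.univ.filter fun σ : Q ≃ Fin (Fintype.card Q) =>
      ∃ q ∈ W, ∀ u ∈ U, σ q ≤ σ u).card = ∑ q ∈ W, (A q).card := by
    intro W hW
    rw [← Finset.card_biUnion]
    · congr 1
      ext σ
      simp [A]
    · intro q hq q' hq' hne
      simp only [Function.onFun]
      rw [Finset.disjoint_left]
      intro σ h1 h2
      simp only [A, Finset.mem_filter, Finset.mem_univ, true_and] at h1 h2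
      exact hne (σ.injective (le_antisymm (h1 _ (hW hq')) (h2 _ (hW hq))))
  obtain ⟨q0, hq0⟩ := hU
  have hc : ∀ q ∈ U, (A q).card = (A q0).card := fun q hq =>
    le_antisymm (hA q hq q0 hq0) (hA q0 hq0 q hq)
  have hall : (Finset.univ.filter fun σ : Q ≃ Fin (Fintype.card Q) =>
      ∃ q ∈ U, ∀ u ∈ U, σ q ≤ σ u) = Finset.univ := by
    apply Finset.filter_true_of_mem
    intro σ _
    exact Finset.exists_min_image U σ ⟨q0, hq0⟩
  have h1 := hcount U subset_rfl
  rw [hall, Finset.card_univ, Finset.sum_congr rfl hc, Finset.sum_const, smul_eq_mul] at h1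
  rw [hcount V hVU, Finset.sum_congr rfl (fun q hq => hc q (hVU hq)), Finset.sum_const,
    smul_eq_mul, h1]
  ring

theorem aux_sep {Γ : Type*} [Group Γ]
    (hrf : ∀ γ : Γ, γ ≠ 1 → ∃ N : Subgroup Γ, N.Normal ∧ N.FiniteIndex ∧ γ ∉ N)
    (N0 : Subgroup Γ) (hn : N0.Normal) (hf : N0.FiniteIndex) (T : Finset Γ) :
    ∃ N : Subgroup Γ, N.Normal ∧ N.FiniteIndex ∧ N ≤ N0 ∧ ∀ t ∈ T, t ∈ N → t = 1 := by
  classical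
  induction T using Finset.induction_on with
  | empty => exact ⟨N0, hn, hf, le_rfl, by simp⟩
  | insert a T _ ih =>
    obtain ⟨N, h1, h2, h3, h4⟩ := ih
    by_cases ha : a = 1
    · refine ⟨N, h1, h2, h3, fun t ht htN => ?_⟩
      rcases Finset.mem_insert.1 ht with rfl | ht
      · exact ha
      · exact h4 t ht htN
    · obtain ⟨M, m1, m2, m3⟩ := hrf a ha
      refine ⟨N ⊓ M, inferInstance, inferInstance, inf_le_left.trans h3, fun t ht htN => ?_⟩
      rcases Finset.mem_insert.1 ht with rfl | ht
      · exact absurd htN.2 m3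
      · exact h4 t ht htN.1

theorem aux_arith (u v a b n c : ℕ) (ε : ℝ) (hε : 0 < ε) (hFp : 0 < c)
    (h1 : a * u = v * n) (h2 : u + v = c + c) (h3 : (u : ℝ) ≤ (1 + ε) * c) (h4 : c ≤ u)
    (h5 : a + b = n) : (b : ℝ) ≤ 2 * ε * n := by
  have hup : (0 : ℝ) < u := by exact_mod_cast hFp.trans_le h4
  rify at h1 h2 h4 h5
  have h6 : (b : ℝ) * u = (u - v) * n := by
    have : (b : ℝ) = n - a := by linarith
    rw [this]; linarith
  have h7 : (u : ℝ) - v ≤ 2 * ε * u := by nlinarith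
  have hn : (0 : ℝ) ≤ n := by positivity
  have h8 : (b : ℝ) * u ≤ (2 * ε * n) * u := by
    rw [h6]; nlinarith
  exact le_of_mul_le_mul_right h8 hup

open scoped Pointwise in
open Classical in
theorem aux_comb {Γ Q : Type*} [Group Γ] [Group Q] [Fintype Q] (π : Γ →* Q)
    (hπ : Function.Surjective π) (S F : Finset Γ) (hF : F.Nonempty) (ε δ : ℝ) (hε : 0 < ε)
    (hεδ : 2 * ε * S.card ≤ δ)
    (hFK : ((F * insert 1 S⁻¹).card : ℝ) ≤ (1 + ε) * F.card)
    (hinj : ∀ f ∈ F, ∀ f' ∈ F, ∀ s ∈ insert 1 S, π (f * s) = π f' → f * s = f') :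
    ∃ τ : Q → Γ, (∀ x, π (τ x) = x) ∧
      ((Finset.univ.filter fun x => ∃ s ∈ S, τ x * s ≠ τ (x * π s)).card : ℝ)
        ≤ δ * Fintype.card Q := by
  have hinj1 : Set.InjOn π F := by
    intro f hf f' hf' h
    have := hinj f hf f' hf' 1 (by simp) (by simpa using h)
    simpa using this
  let C : Q → Finset Q := fun x => F.image fun f => x * (π f)⁻¹
  have hCcard : ∀ x, (C x).card = F.card := by
    intro x
    apply Finset.card_image_of_injOn
    intro f hf f' hf' h
    exact hinj1 hf hf' (by simpa using h)
  have hCne : ∀ x, (C x).Nonempty := fun x => hF.image _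
  have hUcard : ∀ x, ∀ s ∈ S, ((C x ∪ C (x * π s)).card : ℝ) ≤ (1 + ε) * F.card := by
    intro x s hs
    refine le_trans ?_ hFK
    have : C x ∪ C (x * π s) ⊆ (F * insert 1 S⁻¹).image fun f => x * (π f)⁻¹ := by
      intro y hy
      rcases Finset.mem_union.1 hy with hy | hy
      · obtain ⟨f, hf, rfl⟩ := Finset.mem_image.1 hy
        refine Finset.mem_image.2 ⟨f * 1, Finset.mul_mem_mul hf (by simp), by simp⟩
      · obtain ⟨f, hf, rfl⟩ := Finset.mem_image.1 hy
        refine Finset.mem_image.2 ⟨f * s⁻¹, Finset.mul_mem_mul hf ?_, by simp [mul_assoc]⟩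
        exact Finset.mem_insert_of_mem (Finset.inv_mem_inv hs)
    exact_mod_cast (Finset.card_le_card this).trans Finset.card_image_le
  let E := Q ≃ Fin (Fintype.card Q)
  let good : E → Q → Γ → Prop := fun σ x s =>
    ∃ q ∈ C x ∩ C (x * π s), ∀ u ∈ C x ∪ C (x * π s), σ q ≤ σ u
  have hbad : ∀ x, ∀ s ∈ S,
      ((Finset.univ.filter fun σ : E => ¬ good σ x s).card : ℝ) ≤ 2 * ε * Fintype.card E := by
    intro x s hs
    have h1 := aux_perm (C x ∪ C (x * π s)) (C x ∩ C (x * π s))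
      (Finset.inter_subset_union) ((hCne x).mono Finset.subset_union_left)
    have h2 := Finset.card_union_add_card_inter (C x) (C (x * π s))
    rw [hCcard, hCcard] at h2
    have h3 := hUcard x s hs
    have h4 : F.card ≤ (C x ∪ C (x * π s)).card := by
      rw [← hCcard x]; exact Finset.card_le_card Finset.subset_union_left
    have h5 := Finset.card_filter_add_card_filter_not
      (s := (Finset.univ : Finset E)) (fun σ : E => good σ x s)
    rw [Finset.card_univ] at h5
    change (Finset.univ.filter fun σ : E => good σ x s).card * _ = _ * Fintype.card E at h1
    exact aux_arith _ _ _ _ _ _ ε hε hF.card_pos h1 h2 h3 h4 h5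
  have hEne : (Finset.univ : Finset E).Nonempty := ⟨Fintype.equivFin _, Finset.mem_univ _⟩
  obtain ⟨σ, hσ⟩ : ∃ σ : E,
      ((Finset.univ.filter fun x => ∃ s ∈ S, ¬ good σ x s).card : ℝ)
        ≤ δ * Fintype.card Q := by
    have key : ∑ σ : E, ((Finset.univ.filter fun x => ∃ s ∈ S, ¬ good σ x s).card : ℝ)
        ≤ ∑ σ : E, δ * Fintype.card Q := by
      calc ∑ σ : E, ((Finset.univ.filter fun x => ∃ s ∈ S, ¬ good σ x s).card : ℝ)
          ≤ ∑ σ : E, ∑ x : Q, ∑ s ∈ S, (if ¬ good σ x s then (1 : ℝ) else 0) := by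
            refine Finset.sum_le_sum fun σ _ => ?_
            rw [← Finset.sum_boole]
            refine Finset.sum_le_sum fun x _ => ?_
            split_ifs with h
            · obtain ⟨s, hs, hg⟩ := h
              refine le_trans ?_ (Finset.single_le_sum
                (f := fun s => if ¬ good σ x s then (1 : ℝ) else 0) ?_ hs)
              · simp [hg]
              · intro i _
                split_ifs <;> norm_num
            · refine Finset.sum_nonneg fun i _ => ?_
              split_ifs <;> norm_num
        _ = ∑ x : Q, ∑ s ∈ S, ∑ σ : E, (if ¬ good σ x s then (1 : ℝ) else 0) := by
            rw [Finset.sum_comm]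
            exact Finset.sum_congr rfl fun x _ => Finset.sum_comm
        _ ≤ ∑ x : Q, ∑ s ∈ S, 2 * ε * Fintype.card E := by
            refine Finset.sum_le_sum fun x _ => Finset.sum_le_sum fun s hs => ?_
            rw [Finset.sum_boole]
            exact hbad x s hs
        _ = (2 * ε * S.card) * (Fintype.card E * Fintype.card Q) := by
            simp only [Finset.sum_const, Finset.card_univ, nsmul_eq_mul]
            ring
        _ ≤ δ * (Fintype.card E * Fintype.card Q) := by gcongr
        _ = _ := by
            simp only [Finset.sum_const, Finset.card_univ, nsmul_eq_mul]
            ring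
    obtain ⟨σ, _, h⟩ := Finset.exists_le_of_sum_le hEne key
    exact ⟨σ, h⟩
  have hw : ∀ x, ∃ q ∈ C x, ∀ u ∈ C x, σ q ≤ σ u := fun x =>
    Finset.exists_min_image (C x) σ (hCne x)
  choose w hwC hwmin using hw
  have hfx : ∀ x, ∃ f ∈ F, x = w x * π f := by
    intro x
    obtain ⟨f, hf, h⟩ := Finset.mem_image.1 (hwC x)
    exact ⟨f, hf, by rw [← h]; group⟩
  choose f hfF hfw using hfx
  let τ : Q → Γ := fun x => Function.surjInv hπ (w x) * f x
  have hτ : ∀ x, π (τ x) = x := by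
    intro x
    have h1 : π (Function.surjInv hπ (w x)) = w x := Function.surjInv_eq hπ _
    simp only [τ, map_mul, h1]
    exact (hfw x).symm
  have hgood : ∀ x, ∀ s ∈ S, good σ x s → τ x * s = τ (x * π s) := by
    intro x s hs ⟨q, hq, hmin⟩
    have hq' := Finset.mem_inter.1 hq
    have h1 : w x = q := σ.injective (le_antisymm (hwmin x q hq'.1)
      (hmin _ (Finset.mem_union_left _ (hwC x))))
    have h2 : w (x * π s) = q := σ.injective (le_antisymm (hwmin _ q hq'.2)
      (hmin _ (Finset.mem_union_right _ (hwC _))))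
    have h3 := hfw x
    have h4 := hfw (x * π s)
    rw [h1] at h3
    rw [h2] at h4
    have h5 : f x * s = f (x * π s) := by
      apply hinj _ (hfF x) _ (hfF _) s (Finset.mem_insert_of_mem hs)
      rw [map_mul]
      apply mul_left_cancel (a := q)
      rw [← h4, ← mul_assoc, ← h3]
    simp only [τ, h1, h2, mul_assoc, h5]
  refine ⟨τ, hτ, le_trans ?_ hσ⟩
  have hsub : (Finset.univ.filter fun x => ∃ s ∈ S, τ x * s ≠ τ (x * π s)) ⊆
      (Finset.univ.filter fun x => ∃ s ∈ S, ¬ good σ x s) := by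
    intro x hx
    obtain ⟨s, hs, h⟩ := (Finset.mem_filter.1 hx).2
    exact Finset.mem_filter.2 ⟨Finset.mem_univ _, s, hs, fun hg => h (hgood x s hs hg)⟩
  exact_mod_cast Finset.card_le_card hsub

open scoped Pointwise in
open Classical in
theorem aux_step {Γ : Type*} [Group Γ] (ham : IsAmenable Γ)
    (hrf : ∀ γ : Γ, γ ≠ 1 → ∃ N : Subgroup Γ, N.Normal ∧ N.FiniteIndex ∧ γ ∉ N)
    (S : Finset Γ) (N0 : Subgroup Γ) (hn : N0.Normal) (hf : N0.FiniteIndex)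
    (δ : ℝ) (hδ : 0 < δ) :
    ∃ N : Subgroup Γ, N.Normal ∧ N.FiniteIndex ∧ N ≤ N0 ∧ ∃ F : Finset Γ, F.Nonempty ∧
      (Set.ncard {γ : Γ | γ ∈ F ∧ ∃ s ∈ S, γ * s ∉ F} : ℝ) ≤ δ * F.card ∧
      ∀ γ : Γ, ∃! f : Γ, f ∈ F ∧ f⁻¹ * γ ∈ N := by
  obtain ⟨ε, hε, hεδ⟩ : ∃ ε : ℝ, 0 < ε ∧ 2 * ε * S.card ≤ δ := by
    refine ⟨δ / (2 * (S.card + 1)), by positivity, ?_⟩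
    rw [mul_div_assoc', div_mul_eq_mul_div, div_le_iff₀ (by positivity)]
    nlinarith
  obtain ⟨F, hF, hFK⟩ := aux_folner ham (insert 1 S⁻¹) ε hε
  obtain ⟨N, hN, hNf, hNN, hT⟩ := aux_sep hrf N0 hn hf (F⁻¹ * (F * insert 1 S))
  refine ⟨N, hN, hNf, hNN, ?_⟩
  have : Fintype (Γ ⧸ N) := Fintype.ofFinite _
  let π : Γ →* Γ ⧸ N := QuotientGroup.mk' N
  have hinj : ∀ f ∈ F, ∀ f' ∈ F, ∀ s ∈ insert 1 S, π (f * s) = π f' → f * s = f' := by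
    intro f hf f' hf' s hs h
    have h1 : f'⁻¹ * (f * s) ∈ N := by
      have := QuotientGroup.eq.1 h.symm
      simpa using this
    have h2 := hT _ (Finset.mul_mem_mul (Finset.inv_mem_inv hf') (Finset.mul_mem_mul hf hs)) h1
    exact (inv_mul_eq_one.1 h2).symm
  obtain ⟨τ, hτ, hσ⟩ := aux_comb π (QuotientGroup.mk'_surjective N) S F hF ε δ hε hεδ hFK hinj
  have hτinj : Function.Injective τ := fun x y h => by rw [← hτ x, h, hτ y]
  have hcardF : (Finset.univ.image τ).card = Fintype.card (Γ ⧸ N) := by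
    rw [Finset.card_image_of_injective _ hτinj, Finset.card_univ]
  refine ⟨Finset.univ.image τ, Finset.univ_nonempty.image τ, ?_, ?_⟩
  · rw [hcardF]
    refine le_trans ?_ hσ
    have hsub : {γ : Γ | γ ∈ Finset.univ.image τ ∧ ∃ s ∈ S, γ * s ∉ Finset.univ.image τ} ⊆
        (((Finset.univ.filter fun x => ∃ s ∈ S, τ x * s ≠ τ (x * π s)).image τ : Finset Γ) : Set Γ) := by
      rintro γ ⟨hγ, s, hs, hγs⟩
      obtain ⟨x, _, rfl⟩ := Finset.mem_image.1 hγ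
      refine Finset.mem_coe.2 (Finset.mem_image_of_mem _ ?_)
      refine Finset.mem_filter.2 ⟨Finset.mem_univ _, s, hs, fun hg => hγs ?_⟩
      rw [hg]
      exact Finset.mem_image_of_mem _ (Finset.mem_univ _)
    have h1 := Set.ncard_le_ncard hsub (Finset.finite_toSet _)
    rw [Set.ncard_coe_finset] at h1
    exact_mod_cast h1.trans Finset.card_image_le
  · intro γ
    refine ⟨τ (π γ), ⟨Finset.mem_image_of_mem _ (Finset.mem_univ _), ?_⟩, ?_⟩
    · exact QuotientGroup.eq.1 (hτ (π γ))
    · rintro g ⟨hg, hgN⟩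
      obtain ⟨x, _, rfl⟩ := Finset.mem_image.1 hg
      have h1 : π (τ x) = π γ := QuotientGroup.eq.2 hgN
      rw [hτ] at h1
      rw [h1]

/-- **Improved Følner sequences (Weiss; Deninger–Schmidt).**
Let `Γ` be a countable amenable residually finite group and `S ⊆ Γ` a finite subset.
Then there are a decreasing sequence `(Γ_k)` of finite-index normal subgroups of `Γ`
with `⋂_k Γ_k = {1}` and a Følner sequence `(F_k)` of `Γ` with respect to `S` such
that each `F_k` is a complete set of coset representatives for `Γ/Γ_k`. -/
theorem improved_folner_sequences
    {Γ : Type*} [Group Γ] [Countable Γ]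
    (ham : IsAmenable Γ)
    (hrf : ∀ γ : Γ, γ ≠ 1 → ∃ N : Subgroup Γ, N.Normal ∧ N.FiniteIndex ∧ γ ∉ N)
    (S : Finset Γ) :
    ∃ (G : ℕ → Subgroup Γ) (F : ℕ → Finset Γ),
      (∀ k, (G k).Normal) ∧
      (∀ k, (G k).FiniteIndex) ∧
      (∀ k, G (k + 1) ≤ G k) ∧
      (⨅ k, G k) = ⊥ ∧
      (∀ k, (F k).Nonempty) ∧
      Filter.Tendsto
        (fun k => (Set.ncard {γ : Γ | γ ∈ F k ∧ ∃ s ∈ S, γ * s ∉ F k} : ℝ) / (F k).card)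
        Filter.atTop (nhds 0) ∧
      ∀ (k : ℕ) (γ : Γ), ∃! f : Γ, f ∈ F k ∧ f⁻¹ * γ ∈ G k := by
  classical
  obtain ⟨e, he⟩ := exists_surjective_nat Γ
  have hM : ∀ k, ∃ M : Subgroup Γ, M.Normal ∧ M.FiniteIndex ∧ (e k ∈ M → e k = 1) := by
    intro k
    by_cases h : e k = 1
    · exact ⟨⊤, inferInstance, inferInstance, fun _ => h⟩
    · obtain ⟨M, h1, h2, h3⟩ := hrf _ h
      exact ⟨M, h1, h2, fun h' => absurd h' h3⟩
  choose M hM1 hM2 hM3 using hM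
  let P := {N : Subgroup Γ // N.Normal ∧ N.FiniteIndex}
  have hstep : ∀ (k : ℕ) (N : P), ∃ N' : P, N'.1 ≤ N.1 ⊓ M k ∧ ∃ F : Finset Γ, F.Nonempty ∧
      (Set.ncard {γ : Γ | γ ∈ F ∧ ∃ s ∈ S, γ * s ∉ F} : ℝ) ≤ (1 / ((k : ℝ) + 1)) * F.card ∧
      ∀ γ : Γ, ∃! f : Γ, f ∈ F ∧ f⁻¹ * γ ∈ N'.1 := by
    rintro k ⟨N, hN1, hN2⟩
    have := hM1 k
    have := hM2 k
    obtain ⟨N', h1, h2, h3, h4⟩ := aux_step ham hrf S (N ⊓ M k) inferInstance inferInstance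
      (1 / ((k : ℝ) + 1)) (by positivity)
    exact ⟨⟨N', h1, h2⟩, h3, h4⟩
  choose next hle F hFne hFb hFt using hstep
  let H : ℕ → P := fun k => Nat.rec ⟨⊤, inferInstance, inferInstance⟩ (fun k N => next k N) k
  have hH : ∀ k, H (k + 1) = next k (H k) := fun k => rfl
  refine ⟨fun k => (H (k + 1)).1, fun k => F k (H k), fun k => (H (k + 1)).2.1,
    fun k => (H (k + 1)).2.2, fun k => ?_, ?_, fun k => hFne _ _, ?_, fun k γ => ?_⟩
  · exact (hle (k + 1) (H (k + 1))).trans inf_le_left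
  · rw [eq_bot_iff]
    intro γ hγ
    obtain ⟨k, rfl⟩ := he γ
    have h1 := (Subgroup.mem_iInf.1 hγ) k
    exact Subgroup.mem_bot.2 (hM3 k (hle k (H k) h1).2)
  · refine squeeze_zero (fun k => by positivity) (fun k => ?_)
      tendsto_one_div_add_atTop_nhds_zero_nat
    have : (0 : ℝ) < (F k (H k)).card := by exact_mod_cast (hFne k (H k)).card_pos
    rw [div_le_iff₀ this]
    exact hFb k (H k)
  · exact hFt k (H k) γ
end
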